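/- arXiv:2507.01181 — 9 statements merged into one kernel-verified Lean document; each statement's English description precedes it below -/
import Mathlib

section
/- Let A and B be regular convex subsets of ℝⁿ, let E_A be a k-P2S function for A and E_B a k-P2S function for B, and let F := Π_A ∘ Π_B where Π_A(p) = p − ∇E_A(p) and Π_B(p) = p − ∇E_B(p). Then for every point a ∉ A ∩ B, the map F is differentiable at a and the operator norm of its derivative satisfies ‖DF(a)‖ < 1. -/
open scoped RealInnerProductSpace

/-- A set is regular if it is compact and has nonempty interior. -/
def IsRegularSet {n : ℕ} (S : Set (EuclideanSpace ℝ (Fin n))) : Prop :=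
  IsCompact S ∧ (interior S).Nonempty

/-- `f` is a k-th order generalized point-to-set half squared metric (k-P2S) for `S`:
(1) nonnegativity; (2) twice differentiable everywhere with Hessian `0 < ∇²f(p) < I`
off `S` and `∇²f(p) = 0` on `S`; (3) `f` is `k` times continuously differentiable;
(4) `f p = 0 ↔ p ∈ S`. -/
structure IsKP2S {n : ℕ} (k : ℕ) (S : Set (EuclideanSpace ℝ (Fin n)))
    (f : EuclideanSpace ℝ (Fin n) → ℝ) : Prop where
  nonneg : ∀ p, 0 ≤ f p
  twice_diff : Differentiable ℝ f ∧ Differentiable ℝ (fderiv ℝ f)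
  hess_posdef : ∀ p ∉ S, ∀ v, v ≠ 0 → 0 < fderiv ℝ (fderiv ℝ f) p v v
  hess_lt_id : ∀ p ∉ S, ∀ v, v ≠ 0 → fderiv ℝ (fderiv ℝ f) p v v < ‖v‖ ^ 2
  hess_zero : ∀ p ∈ S, fderiv ℝ (fderiv ℝ f) p = 0
  contDiff : ContDiff ℝ k f
  zero_iff : ∀ p, f p = 0 ↔ p ∈ S

/-- The generalized projection associated with a point-to-set metric `f`. -/
noncomputable def genProj {n : ℕ} (f : EuclideanSpace ℝ (Fin n) → ℝ)
    (p : EuclideanSpace ℝ (Fin n)) : EuclideanSpace ℝ (Fin n) :=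
  p - gradient f p

/-- In a finite-dimensional normed space, a linear map that strictly shrinks every nonzero vector
has operator norm less than one. -/
theorem ContinuousLinearMap.opNorm_lt_one_of_norm_apply_lt {V W : Type*} [NormedAddCommGroup V]
    [NormedSpace ℝ V] [FiniteDimensional ℝ V] [NormedAddCommGroup W] [NormedSpace ℝ W]
    (M : V →L[ℝ] W) (hM : ∀ v, v ≠ 0 → ‖M v‖ < ‖v‖) : ‖M‖ < 1 := by
  rcases subsingleton_or_nontrivial V with hV | hV
  · have hzero : M = 0 := Subsingleton.elim _ _
    simp [hzero]
  · have : ProperSpace V := FiniteDimensional.proper ℝ V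
    obtain ⟨u, hu, hmax⟩ := (isCompact_sphere (0 : V) 1).exists_isMaxOn
      (NormedSpace.sphere_nonempty.mpr zero_le_one) (M.continuous.norm.continuousOn)
    have hu1 : ‖u‖ = 1 := by simpa using hu
    have hu0 : u ≠ 0 := norm_ne_zero_iff.mp (by simp [hu1])
    refine lt_of_le_of_lt ?_ (hu1 ▸ hM u hu0)
    exact M.opNorm_le_of_unit_norm (norm_nonneg _) fun x hx => hmax (by simpa using hx)

/-- A symmetric operator whose quadratic form is nonnegative and at most that of the identity
satisfies `‖M v‖ ^ 2 ≤ ⟪M v, v⟫`. -/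
theorem LinearMap.IsSymmetric.norm_apply_sq_le_inner {V : Type*} [NormedAddCommGroup V]
    [InnerProductSpace ℝ V] {M : V →ₗ[ℝ] V} (hsymm : M.IsSymmetric)
    (hnonneg : ∀ v, 0 ≤ ⟪M v, v⟫) (hle : ∀ v, ⟪M v, v⟫ ≤ ‖v‖ ^ 2) (v : V) :
    ‖M v‖ ^ 2 ≤ ⟪M v, v⟫ := by
  have h1 := hnonneg (v - M v)
  have h2 := hle (M v)
  have h3 : ⟪M (M v), v⟫ = ‖M v‖ ^ 2 := by rw [hsymm, real_inner_self_eq_norm_sq]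
  rw [map_sub, inner_sub_left, inner_sub_right, inner_sub_right, h3,
    real_inner_self_eq_norm_sq] at h1
  linarith

/-- The inverse of the Riesz isomorphism of a real Hilbert space, as a linear (rather than
conjugate-linear) map. -/
noncomputable def rieszVector (V : Type*) [NormedAddCommGroup V] [InnerProductSpace ℝ V]
    [CompleteSpace V] : StrongDual ℝ V →L[ℝ] V where
  toFun := (InnerProductSpace.toDual ℝ V).symm
  map_add' := map_add _
  map_smul' c x := by simp
  cont := (InnerProductSpace.toDual ℝ V).symm.continuous

/-- The derivative of the generalized projection: the identity minus the Hessian. -/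
noncomputable def genProjDeriv {n : ℕ} (f : EuclideanSpace ℝ (Fin n) → ℝ)
    (p : EuclideanSpace ℝ (Fin n)) : EuclideanSpace ℝ (Fin n) →L[ℝ] EuclideanSpace ℝ (Fin n) :=
  ContinuousLinearMap.id ℝ _ -
    (rieszVector (EuclideanSpace ℝ (Fin n))).comp (fderiv ℝ (fderiv ℝ f) p)

theorem inner_genProjDeriv {n : ℕ} (f : EuclideanSpace ℝ (Fin n) → ℝ)
    (p v w : EuclideanSpace ℝ (Fin n)) :
    ⟪genProjDeriv f p v, w⟫ = ⟪v, w⟫ - fderiv ℝ (fderiv ℝ f) p v w := by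
  simp [genProjDeriv, rieszVector, inner_sub_left]

namespace IsKP2S

variable {n k : ℕ} {S : Set (EuclideanSpace ℝ (Fin n))} {f : EuclideanSpace ℝ (Fin n) → ℝ}

theorem hasFDerivAt_genProj (hf : IsKP2S k S f) (p : EuclideanSpace ℝ (Fin n)) :
    HasFDerivAt (genProj f) (genProjDeriv f p) p :=
  (hasFDerivAt_id p).sub
    ((rieszVector _).hasFDerivAt.comp p (hf.twice_diff.2 p).hasFDerivAt)

theorem genProjDeriv_isSymmetric (hf : IsKP2S k S f) (p : EuclideanSpace ℝ (Fin n)) :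
    (genProjDeriv f p : EuclideanSpace ℝ (Fin n) →ₗ[ℝ] _).IsSymmetric := by
  intro v w
  have hsymm := second_derivative_symmetric (fun y => (hf.twice_diff.1 y).hasFDerivAt)
    (hf.twice_diff.2 p).hasFDerivAt v w
  rw [ContinuousLinearMap.coe_coe, inner_genProjDeriv, hsymm, real_inner_comm,
    ← inner_genProjDeriv, real_inner_comm]

theorem norm_genProjDeriv_lt_one (hf : IsKP2S k S f) {p : EuclideanSpace ℝ (Fin n)} (hp : p ∉ S) :
    ‖genProjDeriv f p‖ < 1 := by
  have hinner (v : EuclideanSpace ℝ (Fin n)) :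
      ⟪genProjDeriv f p v, v⟫ = ‖v‖ ^ 2 - fderiv ℝ (fderiv ℝ f) p v v := by
    rw [inner_genProjDeriv, real_inner_self_eq_norm_sq]
  have hbound (v : EuclideanSpace ℝ (Fin n)) :
      0 ≤ ⟪genProjDeriv f p v, v⟫ ∧ ⟪genProjDeriv f p v, v⟫ ≤ ‖v‖ ^ 2 := by
    rcases eq_or_ne v 0 with rfl | hv
    · simp
    · have hpos := hf.hess_posdef p hp v hv
      have hlt := hf.hess_lt_id p hp v hv
      constructor <;> linarith [hinner v]
  refine ContinuousLinearMap.opNorm_lt_one_of_norm_apply_lt _ fun v hv => ?_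
  refine lt_of_pow_lt_pow_left₀ 2 (norm_nonneg v) ?_
  have hsq := (hf.genProjDeriv_isSymmetric p).norm_apply_sq_le_inner
    (fun v => (hbound v).1) (fun v => (hbound v).2) v
  rw [ContinuousLinearMap.coe_coe] at hsq
  linarith [hinner v, hf.hess_posdef p hp v hv]

theorem genProjDeriv_of_mem (hf : IsKP2S k S f) {p : EuclideanSpace ℝ (Fin n)} (hp : p ∈ S) :
    genProjDeriv f p = ContinuousLinearMap.id ℝ _ := by
  simp [genProjDeriv, hf.hess_zero p hp]

theorem norm_genProjDeriv_le_one (hf : IsKP2S k S f) (p : EuclideanSpace ℝ (Fin n)) :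
    ‖genProjDeriv f p‖ ≤ 1 := by
  by_cases hp : p ∈ S
  · rw [hf.genProjDeriv_of_mem hp]
    exact ContinuousLinearMap.norm_id_le
  · exact (hf.norm_genProjDeriv_lt_one hp).le

theorem genProj_of_mem (hf : IsKP2S k S f) {p : EuclideanSpace ℝ (Fin n)} (hp : p ∈ S) :
    genProj f p = p := by
  have hmin : IsLocalMin f p := Filter.Eventually.of_forall fun q => by
    rw [(hf.zero_iff p).mpr hp]
    exact hf.nonneg q
  simp [genProj, gradient, hmin.fderiv_eq_zero]

end IsKP2S

/-- For regular convex sets `A`, `B` with k-P2S functions `E_A`, `E_B`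
(`k ≥ 2`), the composite map `F = Π_A ∘ Π_B` is differentiable at every `a ∉ A ∩ B`
with `‖DF(a)‖ < 1`. -/
theorem stmt_1 {n : ℕ} (k : ℕ) (hk : 2 ≤ k)
    (A B : Set (EuclideanSpace ℝ (Fin n)))
    (hAreg : IsRegularSet A) (hAconv : Convex ℝ A)
    (hBreg : IsRegularSet B) (hBconv : Convex ℝ B)
    (EA EB : EuclideanSpace ℝ (Fin n) → ℝ)
    (hEA : IsKP2S k A EA) (hEB : IsKP2S k B EB)
    (F : EuclideanSpace ℝ (Fin n) → EuclideanSpace ℝ (Fin n))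
    (hF : F = genProj EA ∘ genProj EB) :
    ∀ a ∉ A ∩ B, DifferentiableAt ℝ F a ∧ ‖fderiv ℝ F a‖ < 1 := by
  intro a ha
  subst hF
  have hcomp := (hEA.hasFDerivAt_genProj (genProj EB a)).comp a (hEB.hasFDerivAt_genProj a)
  refine ⟨hcomp.differentiableAt, ?_⟩
  rw [hcomp.fderiv]
  refine (ContinuousLinearMap.opNorm_comp_le _ _).trans_lt ?_
  by_cases hB : a ∈ B
  · have hA : a ∉ A := fun h => ha ⟨h, hB⟩
    rw [hEB.genProj_of_mem hB]
    exact mul_lt_one_of_nonneg_of_lt_one_left (norm_nonneg _)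
      (hEA.norm_genProjDeriv_lt_one hA) (hEB.norm_genProjDeriv_le_one a)
  · exact mul_lt_one_of_nonneg_of_lt_one_right (hEA.norm_genProjDeriv_le_one _) (norm_nonneg _)
      (hEB.norm_genProjDeriv_lt_one hB)
end

section
/- Let S be a regular convex subset of ℝⁿ and let E be a k-P2S function for S. Then the generalized projection Π(p) := p − ∇E(p) is an injective map from ℝⁿ to ℝⁿ. -/
open scoped RealInnerProductSpace

/-- If the quadratic form of the second derivative of `f` is everywhere strictly below `‖v‖ ^ 2`,
then `p ↦ p - ∇ f p` is injective. -/
theorem genProj_injective_of_hessian_lt {n : ℕ} {f : EuclideanSpace ℝ (Fin n) → ℝ}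
    (hf : Differentiable ℝ (fderiv ℝ f))
    (hlt : ∀ p v, v ≠ 0 → fderiv ℝ (fderiv ℝ f) p v v < ‖v‖ ^ 2) :
    Function.Injective (genProj f) := by
  intro p q hpq
  by_contra hne
  have hv : q - p ≠ 0 := sub_ne_zero.mpr (Ne.symm hne)
  set v := q - p with hvdef
  have hderiv (t : ℝ) : HasDerivAt (fun t : ℝ => t * ‖v‖ ^ 2 - fderiv ℝ f (p + t • v) v)
      (‖v‖ ^ 2 - fderiv ℝ (fderiv ℝ f) (p + t • v) v v) t := by
    have hline : HasDerivAt (fun t : ℝ => p + t • v) v t := by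
      simpa using ((hasDerivAt_id t).smul_const v).const_add p
    have hcomp := (hf (p + t • v)).hasFDerivAt.comp_hasDerivAt t hline
    have hsq : HasDerivAt (fun t : ℝ => t * ‖v‖ ^ 2) (‖v‖ ^ 2) t := by
      simpa using (hasDerivAt_id t).mul_const (‖v‖ ^ 2)
    simpa using hsq.fun_sub (hcomp.clm_apply (hasDerivAt_const t v))
  have hmono := strictMono_of_deriv_pos fun t => by
    rw [(hderiv t).deriv]
    exact sub_pos.mpr (hlt _ v hv)
  have hlt01 := hmono one_pos
  have hgrad : gradient f q - gradient f p = v := by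
    simp only [genProj] at hpq
    rw [hvdef, sub_eq_sub_iff_add_eq_add]
    rw [sub_eq_sub_iff_add_eq_add] at hpq
    rw [add_comm, add_comm q, add_comm _ q, ← hpq, add_comm]
  have hinner : fderiv ℝ f q v - fderiv ℝ f p v = ‖v‖ ^ 2 := by
    have hdual (x) : fderiv ℝ f x v = ⟪gradient f x, v⟫ := by
      simp [gradient]
    rw [hdual, hdual, ← inner_sub_left, hgrad, real_inner_self_eq_norm_sq]
  have hq : p + v = q := by simp [hvdef]
  simp only [zero_mul, zero_smul, add_zero, one_mul, one_smul, hq] at hlt01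
  linarith

/-- The generalized projection of a k-P2S function for a regular convex
set is injective. -/
theorem stmt_3 {n : ℕ} (k : ℕ) (hk : 2 ≤ k)
    (S : Set (EuclideanSpace ℝ (Fin n)))
    (hSreg : IsRegularSet S) (hSconv : Convex ℝ S)
    (E : EuclideanSpace ℝ (Fin n) → ℝ)
    (hE : IsKP2S k S E) :
    Function.Injective (genProj E) := by
  refine genProj_injective_of_hessian_lt hE.twice_diff.2 fun p v hv => ?_
  by_cases hp : p ∈ S
  · simpa [hE.hess_zero p hp] using pow_pos (norm_pos_iff.mpr hv) 2
  · exact hE.hess_lt_id p hp v hv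
end

section
/- Let A and B be regular convex subsets of ℝⁿ with A ∩ B = ∅, let E_A be a k-P2S function for A and E_B a k-P2S function for B, let a* be the unique fixed point of F := Π_A ∘ Π_B, and let b* := Π_B(a*). Then for every b ∈ ℝⁿ, Λ(a*, b) ≤ Λ(a*, b*), i.e., b* globally maximizes b ↦ Λ(a*, b). -/
open scoped RealInnerProductSpace

/-- A function whose Hessian is bounded above by the identity satisfies the quadratic upper bound
given by its first-order expansion. -/
theorem le_add_fderiv_add_half_norm_sq {V : Type*} [NormedAddCommGroup V] [NormedSpace ℝ V]
    {f : V → ℝ} (hf : Differentiable ℝ f) (hf' : Differentiable ℝ (fderiv ℝ f))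
    (hess : ∀ p v, fderiv ℝ (fderiv ℝ f) p v v ≤ ‖v‖ ^ 2) (x y : V) :
    f y ≤ f x + fderiv ℝ f x (y - x) + ‖y - x‖ ^ 2 / 2 := by
  set v := y - x
  have hline (t : ℝ) : HasDerivAt (fun s : ℝ => x + s • v) v t := by
    simpa using ((hasDerivAt_id t).smul_const v).const_add x
  have hfirst (t : ℝ) : HasDerivAt
      (fun s : ℝ => f (x + s • v) - s * fderiv ℝ f x v - s ^ 2 / 2 * ‖v‖ ^ 2)
      (fderiv ℝ f (x + t • v) v - fderiv ℝ f x v - t * ‖v‖ ^ 2) t := by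
    have h₁ := (hf (x + t • v)).hasFDerivAt.comp_hasDerivAt t (hline t)
    have h₂ := (hasDerivAt_id t).mul_const (fderiv ℝ f x v)
    have h₃ := (((hasDerivAt_id t).pow 2).div_const 2).mul_const (‖v‖ ^ 2)
    refine ((h₁.sub h₂).sub h₃).congr_deriv ?_
    simp
  have hsecond (t : ℝ) : HasDerivAt
      (fun s : ℝ => fderiv ℝ f (x + s • v) v - fderiv ℝ f x v - s * ‖v‖ ^ 2)
      (fderiv ℝ (fderiv ℝ f) (x + t • v) v v - ‖v‖ ^ 2) t := by
    have h₀ : HasDerivAt (fun s : ℝ => fderiv ℝ f (x + s • v))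
        (fderiv ℝ (fderiv ℝ f) (x + t • v) v) t :=
      (hf' (x + t • v)).hasFDerivAt.comp_hasDerivAt t (hline t)
    have h₁ : HasDerivAt (fun s : ℝ => fderiv ℝ f (x + s • v) v)
        (fderiv ℝ (fderiv ℝ f) (x + t • v) v v) t := by
      simpa using h₀.clm_apply (hasDerivAt_const t v)
    have h₂ := (hasDerivAt_id t).mul_const (‖v‖ ^ 2)
    refine ((h₁.sub_const (fderiv ℝ f x v)).sub h₂).congr_deriv ?_
    simp
  have hanti := antitone_of_hasDerivAt_nonpos hsecond fun t => sub_nonpos.2 (hess _ v)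
  have hle : AntitoneOn
      (fun s : ℝ => f (x + s • v) - s * fderiv ℝ f x v - s ^ 2 / 2 * ‖v‖ ^ 2) (Set.Icc 0 1) := by
    refine antitoneOn_of_deriv_nonpos (convex_Icc 0 1)
      (fun t _ => (hfirst t).continuousAt.continuousWithinAt)
      (fun t _ => (hfirst t).differentiableAt.differentiableWithinAt) fun t ht => ?_
    rw [(hfirst t).deriv]
    simpa using hanti (interior_subset ht).1
  have h := hle (Set.left_mem_Icc.2 zero_le_one) (Set.right_mem_Icc.2 zero_le_one) zero_le_one
  have hy : x + v = y := add_sub_cancel x y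
  simp only [one_smul, zero_smul, add_zero, hy] at h
  linarith

theorem IsKP2S.hess_le {n k : ℕ} {S : Set (EuclideanSpace ℝ (Fin n))}
    {f : EuclideanSpace ℝ (Fin n) → ℝ} (hf : IsKP2S k S f) (p v : EuclideanSpace ℝ (Fin n)) :
    fderiv ℝ (fderiv ℝ f) p v v ≤ ‖v‖ ^ 2 := by
  by_cases hp : p ∈ S
  · simp [hf.hess_zero p hp]
  · rcases eq_or_ne v 0 with rfl | hv
    · simp
    · exact (hf.hess_lt_id p hp v hv).le

/-- `b*` globally maximizes `b ↦ Λ(a*, b)`. -/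
theorem stmt_5 {n : ℕ} (k : ℕ) (hk : 2 ≤ k)
    (A B : Set (EuclideanSpace ℝ (Fin n)))
    (hAreg : IsRegularSet A) (hAconv : Convex ℝ A)
    (hBreg : IsRegularSet B) (hBconv : Convex ℝ B)
    (hdisj : A ∩ B = ∅)
    (EA EB : EuclideanSpace ℝ (Fin n) → ℝ)
    (hEA : IsKP2S k A EA) (hEB : IsKP2S k B EB)
    (F : EuclideanSpace ℝ (Fin n) → EuclideanSpace ℝ (Fin n))
    (hF : F = genProj EA ∘ genProj EB)
    (astar bstar : EuclideanSpace ℝ (Fin n))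
    (hfix : F astar = astar) (huniq : ∀ a, F a = a → a = astar)
    (hbstar : bstar = genProj EB astar)
    (Λ : EuclideanSpace ℝ (Fin n) → EuclideanSpace ℝ (Fin n) → ℝ)
    (hΛ : ∀ a b, Λ a b = EA b + EB a - ‖a - b‖ ^ 2 / 2) :
    ∀ b, Λ astar b ≤ Λ astar bstar := by
  intro b
  have hgrad : gradient EA bstar = bstar - astar := by
    have h : bstar - gradient EA bstar = astar := by
      rw [hF, Function.comp_apply, ← hbstar] at hfix
      exact hfix
    rw [← h, sub_sub_cancel]
  have hbound := le_add_fderiv_add_half_norm_sq hEA.twice_diff.1 hEA.twice_diff.2 hEA.hess_le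
    bstar b
  have hinner : fderiv ℝ EA bstar (b - bstar) = ⟪bstar - astar, b - bstar⟫ := by
    rw [← hgrad, gradient, InnerProductSpace.toDual_symm_apply]
  have hnorm : ‖astar - b‖ ^ 2 =
      ‖astar - bstar‖ ^ 2 + 2 * ⟪bstar - astar, b - bstar⟫ + ‖b - bstar‖ ^ 2 := by
    rw [norm_sub_rev astar b, norm_sub_rev astar bstar, ← norm_add_sq_real,
      add_comm (bstar - astar), sub_add_sub_cancel]
  rw [hΛ, hΛ]
  linarith
end

section
/- Let A and B be regular convex subsets of ℝⁿ with A ∩ B = ∅, let E_A be a k-P2S function for A and E_B a k-P2S function for B, let a* be the unique fixed point of F := Π_A ∘ Π_B, and let b* := Π_B(a*). Then for every a ∈ ℝⁿ there exists b ∈ ℝⁿ such that Λ(a, b) ≥ Λ(a*, b*); i.e., a* minimizes the function a ↦ sup_b Λ(a,b). -/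
open scoped RealInnerProductSpace

/-- First-order convexity inequality for a twice differentiable function with positive
semidefinite Hessian. -/
theorem add_fderiv_sub_le_of_hessian_nonneg {V : Type*} [NormedAddCommGroup V] [NormedSpace ℝ V]
    {f : V → ℝ} (hf : Differentiable ℝ f) (hf' : Differentiable ℝ (fderiv ℝ f))
    (hess : ∀ p v, 0 ≤ fderiv ℝ (fderiv ℝ f) p v v) (x y : V) :
    f x + fderiv ℝ f x (y - x) ≤ f y := by
  have hline : ∀ t : ℝ, HasDerivAt (fun t : ℝ => x + t • (y - x)) (y - x) t := fun t => by
    simpa using ((hasDerivAt_id t).smul_const (y - x)).const_add x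
  have hderiv : ∀ t : ℝ, HasDerivAt (fun t : ℝ => f (x + t • (y - x)))
      (fderiv ℝ f (x + t • (y - x)) (y - x)) t := fun t =>
    (hf _).hasFDerivAt.comp_hasDerivAt t (hline t)
  have hderiv2 : ∀ t : ℝ, HasDerivAt (fun t : ℝ => fderiv ℝ f (x + t • (y - x)) (y - x))
      (fderiv ℝ (fderiv ℝ f) (x + t • (y - x)) (y - x) (y - x)) t := fun t => by
    simpa using ((hf' _).hasFDerivAt.comp_hasDerivAt t (hline t)).clm_apply
      (hasDerivAt_const t (y - x))
  have hmono : Monotone fun t : ℝ => fderiv ℝ f (x + t • (y - x)) (y - x) :=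
    monotone_of_deriv_nonneg (fun t => (hderiv2 t).differentiableAt)
      fun t => by rw [(hderiv2 t).deriv]; exact hess _ _
  obtain ⟨c, hc, hslope⟩ := exists_hasDerivAt_eq_slope _ _ zero_lt_one
    (fun t _ => (hderiv t).continuousAt.continuousWithinAt) fun t _ => hderiv t
  have hle := hmono hc.1.le
  simp only [zero_smul, add_zero, one_smul, add_sub_cancel, sub_zero, div_one] at hle hslope
  linarith

/-- A k-P2S function lies above its tangent hyperplanes. -/
theorem IsKP2S.add_inner_gradient_le {n k : ℕ} {S : Set (EuclideanSpace ℝ (Fin n))}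
    {f : EuclideanSpace ℝ (Fin n) → ℝ} (h : IsKP2S k S f) (x y : EuclideanSpace ℝ (Fin n)) :
    f x + ⟪gradient f x, y - x⟫ ≤ f y := by
  have hess : ∀ p v, 0 ≤ fderiv ℝ (fderiv ℝ f) p v v := fun p v => by
    by_cases hp : p ∈ S
    · simp [h.hess_zero p hp]
    · rcases eq_or_ne v 0 with rfl | hv
      · simp
      · exact (h.hess_posdef p hp v hv).le
  simpa [gradient] using
    add_fderiv_sub_le_of_hessian_nonneg h.twice_diff.1 h.twice_diff.2 hess x y

/-- `a*` minimizes `a ↦ sup_b Λ(a,b)`: for every `a` there is `b` with `Λ(a,b) ≥ Λ(a*,b*)`. -/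
theorem stmt_6 {n : ℕ} (k : ℕ) (hk : 2 ≤ k)
    (A B : Set (EuclideanSpace ℝ (Fin n)))
    (hAreg : IsRegularSet A) (hAconv : Convex ℝ A)
    (hBreg : IsRegularSet B) (hBconv : Convex ℝ B)
    (hdisj : A ∩ B = ∅)
    (EA EB : EuclideanSpace ℝ (Fin n) → ℝ)
    (hEA : IsKP2S k A EA) (hEB : IsKP2S k B EB)
    (F : EuclideanSpace ℝ (Fin n) → EuclideanSpace ℝ (Fin n))
    (hF : F = genProj EA ∘ genProj EB)
    (astar bstar : EuclideanSpace ℝ (Fin n))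
    (hfix : F astar = astar) (huniq : ∀ a, F a = a → a = astar)
    (hbstar : bstar = genProj EB astar)
    (Λ : EuclideanSpace ℝ (Fin n) → EuclideanSpace ℝ (Fin n) → ℝ)
    (hΛ : ∀ a b, Λ a b = EA b + EB a - ‖a - b‖ ^ 2 / 2) :
    ∀ a, ∃ b, Λ astar bstar ≤ Λ a b := by
  intro a
  have hgradB : gradient EB astar = astar - bstar := by
    rw [hbstar, genProj]; abel
  have hgradA : gradient EA bstar = bstar - astar := by
    have hproj : bstar - gradient EA bstar = astar := by
      rw [hF, Function.comp_apply, ← hbstar] at hfix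
      exact hfix
    rw [← hproj]; abel
  -- Translating `b*` along with `a*` keeps the distance term of `Λ` unchanged.
  refine ⟨bstar + (a - astar), ?_⟩
  have hA := hEA.add_inner_gradient_le bstar (bstar + (a - astar))
  have hB := hEB.add_inner_gradient_le astar a
  rw [hgradA, add_sub_cancel_left, ← neg_sub astar bstar, inner_neg_left] at hA
  rw [hgradB] at hB
  have hdist : a - (bstar + (a - astar)) = astar - bstar := by abel
  rw [hΛ, hΛ, hdist]
  linarith
end

section
/- Let A and B be regular convex subsets of ℝⁿ with A ∩ B = ∅, let E_A be a k-P2S function for A and E_B a k-P2S function for B, let a* be the unique fixed point of F := Π_A ∘ Π_B, and let b* := Π_B(a*). Let a₀* ∈ A be a point of A at minimal Euclidean distance to B, i.e., dist(a₀*, B) ≤ dist(a, B) for all a ∈ A. Then Λ(a*, b*) ≤ E_B(a₀*). -/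
open scoped RealInnerProductSpace

/-- A function on `ℝ` with nonnegative second derivative lies above its tangent line at `0`. -/
theorem add_deriv_le_of_second_deriv_nonneg {g g' g'' : ℝ → ℝ}
    (hg : ∀ t, HasDerivAt g (g' t) t) (hg' : ∀ t, HasDerivAt g' (g'' t) t)
    (hnonneg : ∀ t, 0 ≤ g'' t) : g 0 + g' 0 ≤ g 1 := by
  have hmono : Monotone g' :=
    monotone_of_deriv_nonneg (fun t => (hg' t).differentiableAt)
      (fun t => by rw [(hg' t).deriv]; exact hnonneg t)
  obtain ⟨c, hc, hslope⟩ := exists_hasDerivAt_eq_slope g g' zero_lt_one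
    (fun t _ => (hg t).continuousAt.continuousWithinAt) (fun t _ => hg t)
  have := hmono hc.1.le
  rw [hslope] at this
  linarith

namespace IsKP2S

variable {n k : ℕ} {S : Set (EuclideanSpace ℝ (Fin n))} {f : EuclideanSpace ℝ (Fin n) → ℝ}

theorem hess_nonneg (hf : IsKP2S k S f) (p v : EuclideanSpace ℝ (Fin n)) :
    0 ≤ fderiv ℝ (fderiv ℝ f) p v v := by
  by_cases hp : p ∈ S
  · simp [hf.hess_zero p hp]
  · rcases eq_or_ne v 0 with rfl | hv
    · simp
    · exact (hf.hess_posdef p hp v hv).le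

theorem hess_le_norm_sq (hf : IsKP2S k S f) (p v : EuclideanSpace ℝ (Fin n)) :
    fderiv ℝ (fderiv ℝ f) p v v ≤ ‖v‖ ^ 2 := by
  by_cases hp : p ∈ S
  · simp [hf.hess_zero p hp]
  · rcases eq_or_ne v 0 with rfl | hv
    · simp
    · exact (hf.hess_lt_id p hp v hv).le

theorem hasDerivAt_line (hf : IsKP2S k S f) (x v : EuclideanSpace ℝ (Fin n)) (t : ℝ) :
    HasDerivAt (fun s : ℝ => f (x + s • v)) (fderiv ℝ f (x + t • v) v) t := by
  have hline : HasDerivAt (fun s : ℝ => x + s • v) v t := by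
    simpa using ((hasDerivAt_id t).smul_const v).const_add x
  exact (hf.twice_diff.1 _).hasFDerivAt.comp_hasDerivAt t hline

theorem hasDerivAt_fderiv_line (hf : IsKP2S k S f) (x v : EuclideanSpace ℝ (Fin n)) (t : ℝ) :
    HasDerivAt (fun s : ℝ => fderiv ℝ f (x + s • v) v)
      (fderiv ℝ (fderiv ℝ f) (x + t • v) v v) t := by
  have hline : HasDerivAt (fun s : ℝ => x + s • v) v t := by
    simpa using ((hasDerivAt_id t).smul_const v).const_add x
  have hcomp := (hf.twice_diff.2 _).hasFDerivAt.comp_hasDerivAt t hline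
  simpa using hcomp.clm_apply (hasDerivAt_const t v)

/-- A P2S function lies above its tangent planes. -/
theorem add_fderiv_le (hf : IsKP2S k S f) (x v : EuclideanSpace ℝ (Fin n)) :
    f x + fderiv ℝ f x v ≤ f (x + v) := by
  simpa using add_deriv_le_of_second_deriv_nonneg (hf.hasDerivAt_line x v)
    (hf.hasDerivAt_fderiv_line x v) (fun t => hf.hess_nonneg _ v)

/-- The quadratic upper bound for a function whose Hessian is at most the identity. -/
theorem le_add_fderiv_add_norm_sq (hf : IsKP2S k S f) (x v : EuclideanSpace ℝ (Fin n)) :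
    f (x + v) ≤ f x + fderiv ℝ f x v + ‖v‖ ^ 2 / 2 := by
  have hquad (t : ℝ) : HasDerivAt (fun s : ℝ => s ^ 2 * (‖v‖ ^ 2 / 2)) (t * ‖v‖ ^ 2) t := by
    refine ((hasDerivAt_pow 2 t).mul_const (‖v‖ ^ 2 / 2)).congr_deriv ?_
    norm_num
    ring
  have hlin (t : ℝ) : HasDerivAt (fun s : ℝ => s * ‖v‖ ^ 2) (‖v‖ ^ 2) t := by
    simpa using (hasDerivAt_id t).mul_const (‖v‖ ^ 2)
  have h := add_deriv_le_of_second_deriv_nonneg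
    (g := fun s => s ^ 2 * (‖v‖ ^ 2 / 2) - f (x + s • v))
    (fun t => (hquad t).sub (hf.hasDerivAt_line x v t))
    (fun t => (hlin t).sub (hf.hasDerivAt_fderiv_line x v t))
    (fun t => sub_nonneg.2 (hf.hess_le_norm_sq _ v))
  simp at h
  linarith

theorem fderiv_eq_zero_of_mem (hf : IsKP2S k S f) {p : EuclideanSpace ℝ (Fin n)} (hp : p ∈ S) :
    fderiv ℝ f p = 0 := by
  refine IsLocalMin.fderiv_eq_zero (Filter.Eventually.of_forall fun q => ?_)
  rw [(hf.zero_iff p).2 hp]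
  exact hf.nonneg q

/-- Cocoercivity of the gradient, relative to a point of the zero set. -/
theorem add_gradient_norm_sq_le (hf : IsKP2S k S f) {p : EuclideanSpace ℝ (Fin n)} (hp : p ∈ S)
    (x : EuclideanSpace ℝ (Fin n)) :
    f x + ‖gradient f x‖ ^ 2 / 2 ≤ ⟪gradient f x, x - p⟫ := by
  have hlower := hf.add_fderiv_le x (p + gradient f x - x)
  have hupper := hf.le_add_fderiv_add_norm_sq p (gradient f x)
  rw [add_sub_cancel, ← inner_gradient_left] at hlower
  rw [hf.fderiv_eq_zero_of_mem hp, (hf.zero_iff p).2 hp] at hupper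
  have hsplit : ⟪gradient f x, p + gradient f x - x⟫
      = ‖gradient f x‖ ^ 2 - ⟪gradient f x, x - p⟫ := by
    rw [← real_inner_self_eq_norm_sq, ← inner_sub_right]
    congr 1
    abel
  simp only [zero_apply] at hupper
  linarith

end IsKP2S

/-- if `a₀* ∈ A` achieves the minimal Euclidean distance from `A` to `B`,
then `Λ(a*, b*) ≤ E_B(a₀*)`. -/
theorem stmt_7 {n : ℕ} (k : ℕ) (hk : 2 ≤ k)
    (A B : Set (EuclideanSpace ℝ (Fin n)))
    (hAreg : IsRegularSet A) (hAconv : Convex ℝ A)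
    (hBreg : IsRegularSet B) (hBconv : Convex ℝ B)
    (hdisj : A ∩ B = ∅)
    (EA EB : EuclideanSpace ℝ (Fin n) → ℝ)
    (hEA : IsKP2S k A EA) (hEB : IsKP2S k B EB)
    (F : EuclideanSpace ℝ (Fin n) → EuclideanSpace ℝ (Fin n))
    (hF : F = genProj EA ∘ genProj EB)
    (astar bstar : EuclideanSpace ℝ (Fin n))
    (hfix : F astar = astar) (huniq : ∀ a, F a = a → a = astar)
    (hbstar : bstar = genProj EB astar)
    (Λ : EuclideanSpace ℝ (Fin n) → EuclideanSpace ℝ (Fin n) → ℝ)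
    (hΛ : ∀ a b, Λ a b = EA b + EB a - ‖a - b‖ ^ 2 / 2)
    (a0star : EuclideanSpace ℝ (Fin n)) (ha0A : a0star ∈ A)
    (ha0min : ∀ a ∈ A, Metric.infDist a0star B ≤ Metric.infDist a B) :
    Λ astar bstar ≤ EB a0star := by
  have hgradB : gradient EB astar = astar - bstar := by
    rw [hbstar, genProj, sub_sub_cancel]
  have hgradA : gradient EA bstar = bstar - astar := by
    have hproj : bstar - gradient EA bstar = astar := by
      rw [hF, Function.comp_apply, ← hbstar] at hfix
      exact hfix
    rw [← hproj, sub_sub_cancel]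
  have hB := hEB.add_fderiv_le astar (a0star - astar)
  have hA := hEA.add_gradient_norm_sq_le ha0A bstar
  rw [add_sub_cancel, ← inner_gradient_left, hgradB] at hB
  rw [hgradA, norm_sub_rev] at hA
  have hinner : ⟪bstar - astar, bstar - a0star⟫
      = ‖astar - bstar‖ ^ 2 + ⟪astar - bstar, a0star - astar⟫ := by
    rw [← real_inner_self_eq_norm_sq, ← inner_add_right, ← neg_sub astar bstar, inner_neg_left,
      ← inner_neg_right]
    congr 1
    abel
  rw [hΛ]
  linarith
end

section
/- Let A and B be regular convex subsets of ℝⁿ with A ∩ B = ∅, let E_A be a k-P2S function for A and E_B a k-P2S function for B, let a* be the unique fixed point of F := Π_A ∘ Π_B, and let b* := Π_B(a*). Then Λ(a*, b*) ≥ inf { E_A(a) + E_B(a) : a ∈ ℝⁿ }. -/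
open scoped RealInnerProductSpace

/-- Descent lemma: a function whose Hessian is bounded above by the identity lies below its
quadratic upper model at every point. -/
theorem le_quadratic_model_of_hessian_le {V : Type*} [NormedAddCommGroup V] [NormedSpace ℝ V]
    {f : V → ℝ} (hf : Differentiable ℝ f) (hf' : Differentiable ℝ (fderiv ℝ f))
    (hle : ∀ p v, fderiv ℝ (fderiv ℝ f) p v v ≤ ‖v‖ ^ 2) (x v : V) :
    f (x + v) ≤ f x + fderiv ℝ f x v + ‖v‖ ^ 2 / 2 := by
  have hline (t : ℝ) : HasDerivAt (fun t : ℝ => x + t • v) v t := by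
    simpa using ((hasDerivAt_id t).smul_const v).const_add x
  have hslope (t : ℝ) : HasDerivAt (fun t : ℝ => fderiv ℝ f (x + t • v) v - t * ‖v‖ ^ 2)
      (fderiv ℝ (fderiv ℝ f) (x + t • v) v v - ‖v‖ ^ 2) t := by
    have h : HasDerivAt (fun t : ℝ => fderiv ℝ f (x + t • v))
        (fderiv ℝ (fderiv ℝ f) (x + t • v) v) t :=
      (hf' (x + t • v)).hasFDerivAt.comp_hasDerivAt t (hline t)
    have hv : HasDerivAt (fun t : ℝ => fderiv ℝ f (x + t • v) v)
        (fderiv ℝ (fderiv ℝ f) (x + t • v) v v) t :=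
      (ContinuousLinearMap.apply ℝ ℝ v).hasFDerivAt.comp_hasDerivAt t h
    have hlin : HasDerivAt (fun t : ℝ => t * ‖v‖ ^ 2) (‖v‖ ^ 2) t := by
      simpa using (hasDerivAt_id t).mul_const (‖v‖ ^ 2)
    exact hv.sub hlin
  have hanti : Antitone (fun t : ℝ => fderiv ℝ f (x + t • v) v - t * ‖v‖ ^ 2) :=
    antitone_of_deriv_nonpos (fun t => (hslope t).differentiableAt) fun t => by
      rw [(hslope t).deriv]
      exact sub_nonpos.2 (hle _ _)
  have hgap (t : ℝ) : HasDerivAt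
      (fun t : ℝ => f (x + t • v) - t * fderiv ℝ f x v - t ^ 2 * (‖v‖ ^ 2 / 2))
      (fderiv ℝ f (x + t • v) v - fderiv ℝ f x v - t * ‖v‖ ^ 2) t := by
    have h := (((hf (x + t • v)).hasFDerivAt.comp_hasDerivAt t (hline t)).sub
      ((hasDerivAt_id t).mul_const (fderiv ℝ f x v))).sub
      ((hasDerivAt_pow 2 t).mul_const (‖v‖ ^ 2 / 2))
    refine h.congr_deriv ?_
    norm_num
    ring
  have hgap_anti : AntitoneOn
      (fun t : ℝ => f (x + t • v) - t * fderiv ℝ f x v - t ^ 2 * (‖v‖ ^ 2 / 2))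
      (Set.Icc 0 1) := by
    refine antitoneOn_of_deriv_nonpos (convex_Icc 0 1)
      (fun t _ => (hgap t).continuousAt.continuousWithinAt)
      (fun t _ => (hgap t).differentiableAt.differentiableWithinAt) fun t ht => ?_
    rw [interior_Icc] at ht
    rw [(hgap t).deriv]
    have h := hanti ht.1.le
    simp only [zero_smul, add_zero, zero_mul, sub_zero] at h
    linarith
  have h := hgap_anti (Set.left_mem_Icc.2 zero_le_one) (Set.right_mem_Icc.2 zero_le_one)
    zero_le_one
  simp only [zero_smul, one_smul, add_zero, zero_mul, one_mul, sub_zero, one_pow, ne_eq,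
    OfNat.ofNat_ne_zero, not_false_eq_true, zero_pow] at h
  linarith

theorem IsKP2S.hessian_le {n k : ℕ} {S : Set (EuclideanSpace ℝ (Fin n))}
    {f : EuclideanSpace ℝ (Fin n) → ℝ} (h : IsKP2S k S f) (p v : EuclideanSpace ℝ (Fin n)) :
    fderiv ℝ (fderiv ℝ f) p v v ≤ ‖v‖ ^ 2 := by
  by_cases hp : p ∈ S
  · simp [h.hess_zero p hp]
  · rcases eq_or_ne v 0 with rfl | hv
    · simp
    · exact (h.hess_lt_id p hp v hv).le

/-- Moving from `p` to its generalized projection decreases a k-P2S function by at least half the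
squared displacement. -/
theorem IsKP2S.apply_genProj_le {n k : ℕ} {S : Set (EuclideanSpace ℝ (Fin n))}
    {f : EuclideanSpace ℝ (Fin n) → ℝ} (h : IsKP2S k S f) (p : EuclideanSpace ℝ (Fin n)) :
    f (genProj f p) ≤ f p - ‖genProj f p - p‖ ^ 2 / 2 := by
  have hmodel := le_quadratic_model_of_hessian_le h.twice_diff.1 h.twice_diff.2 h.hessian_le p
    (-gradient f p)
  have hgrad : fderiv ℝ f p (gradient f p) = ‖gradient f p‖ ^ 2 := by
    rw [← real_inner_self_eq_norm_sq, inner_gradient_left]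
  rw [map_neg, hgrad, norm_neg] at hmodel
  have hdisp : genProj f p - p = -gradient f p := by simp [genProj]
  rw [hdisp, norm_neg, genProj, sub_eq_add_neg]
  linarith

/-- `Λ(a*,b*) ≥ inf_a (E_A(a) + E_B(a))`. -/
theorem stmt_8 {n : ℕ} (k : ℕ) (hk : 2 ≤ k)
    (A B : Set (EuclideanSpace ℝ (Fin n)))
    (hAreg : IsRegularSet A) (hAconv : Convex ℝ A)
    (hBreg : IsRegularSet B) (hBconv : Convex ℝ B)
    (hdisj : A ∩ B = ∅)
    (EA EB : EuclideanSpace ℝ (Fin n) → ℝ)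
    (hEA : IsKP2S k A EA) (hEB : IsKP2S k B EB)
    (F : EuclideanSpace ℝ (Fin n) → EuclideanSpace ℝ (Fin n))
    (hF : F = genProj EA ∘ genProj EB)
    (astar bstar : EuclideanSpace ℝ (Fin n))
    (hfix : F astar = astar) (huniq : ∀ a, F a = a → a = astar)
    (hbstar : bstar = genProj EB astar)
    (Λ : EuclideanSpace ℝ (Fin n) → EuclideanSpace ℝ (Fin n) → ℝ)
    (hΛ : ∀ a b, Λ a b = EA b + EB a - ‖a - b‖ ^ 2 / 2) :
    (⨅ a : EuclideanSpace ℝ (Fin n), (EA a + EB a)) ≤ Λ astar bstar := by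
  have hproj : genProj EA bstar = astar := by
    rw [hF, Function.comp_apply, ← hbstar] at hfix
    exact hfix
  have hdescent := hEA.apply_genProj_le bstar
  rw [hproj] at hdescent
  have hbdd : BddBelow (Set.range fun a => EA a + EB a) :=
    ⟨0, by rintro _ ⟨a, rfl⟩; exact add_nonneg (hEA.nonneg a) (hEB.nonneg a)⟩
  refine (ciInf_le hbdd astar).trans ?_
  rw [hΛ]
  linarith
end

section
/- Let k ≥ 1 and let F : ℝⁿ × ℝ → ℝⁿ be k times continuously differentiable. Suppose a* : ℝ → ℝⁿ is a continuous function satisfying a*(τ) = F(a*(τ), τ) for all τ ∈ ℝ, and suppose that for every τ the operator norm of the partial Fréchet derivative of F with respect to its first argument, evaluated at (a*(τ), τ), is strictly less than 1. Then a* is k times continuously differentiable. -/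
/-- If `‖A‖ < 1` on a Banach space, then `id - A` is invertible (Neumann series). -/
theorem ContinuousLinearMap.isInvertible_id_sub_of_norm_lt_one {𝕜 E : Type*}
    [NontriviallyNormedField 𝕜] [NormedAddCommGroup E] [NormedSpace 𝕜 E] [CompleteSpace E]
    {A : E →L[𝕜] E} (hA : ‖A‖ < 1) : (ContinuousLinearMap.id 𝕜 E - A).IsInvertible := by
  obtain ⟨v, hv⟩ := isUnit_one_sub_of_norm_lt_one hA
  exact ⟨ContinuousLinearEquiv.unitsEquiv 𝕜 E v, hv⟩

/-- A function `g`, continuous at `x`, that solves a `C^n` equation `f (y, g y) = f (x, g x)` near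
`x` is `C^n` at `x`, provided that the partial derivative of `f` in its second argument is
invertible at `(x, g x)`. -/
theorem ContDiffAt.contDiffAt_of_eventually_apply_eq {𝕜 E₁ E₂ F : Type*} [RCLike 𝕜]
    [NormedAddCommGroup E₁] [NormedSpace 𝕜 E₁] [CompleteSpace E₁]
    [NormedAddCommGroup E₂] [NormedSpace 𝕜 E₂] [CompleteSpace E₂]
    [NormedAddCommGroup F] [NormedSpace 𝕜 F] [CompleteSpace F]
    {m : WithTop ℕ∞} {f : E₁ × E₂ → F} {g : E₁ → E₂} {x : E₁}
    (hf : ContDiffAt 𝕜 m f (x, g x)) (hm : m ≠ 0)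
    (hinv : (fderiv 𝕜 (fun p => f (x, p)) (g x)).IsInvertible)
    (hg : ContinuousAt g x) (hfg : ∀ᶠ y in nhds x, f (y, g y) = f (x, g x)) :
    ContDiffAt 𝕜 m g x := by
  have hpartial : HasFDerivAt (fun p => f (x, p))
      (fderiv 𝕜 f (x, g x) ∘L .inr 𝕜 E₁ E₂) (g x) :=
    (hf.differentiableAt hm).hasFDerivAt.comp (g x) (hasFDerivAt_prodMk_right x (g x))
  rw [hpartial.fderiv] at hinv
  have htendsto : Filter.Tendsto (fun y => (y, g y)) (nhds x) (nhds (x, g x)) :=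
    continuousAt_id.prodMk hg
  refine (hf.contDiffAt_implicitFunction hm hinv).congr_of_eventuallyEq ?_
  filter_upwards [hfg, htendsto.eventually (hf.eventually_apply_eq_iff_implicitFunction hm hinv)]
    with y hy hiff
  exact (hiff.mp hy).symm

/-- if `F : ℝⁿ × ℝ → ℝⁿ` is `C^k` (`k ≥ 1`), `a* : ℝ → ℝⁿ` is a
continuous family of fixed points `a*(τ) = F(a*(τ), τ)`, and the partial derivative
of `F` in its first argument at `(a*(τ), τ)` has operator norm `< 1` for every `τ`,
then `a*` is `C^k`. -/
theorem stmt_10 {n : ℕ} (k : ℕ) (hk : 1 ≤ k)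
    (F : EuclideanSpace ℝ (Fin n) × ℝ → EuclideanSpace ℝ (Fin n))
    (hF : ContDiff ℝ k F)
    (astar : ℝ → EuclideanSpace ℝ (Fin n))
    (hcont : Continuous astar)
    (hfix : ∀ τ : ℝ, astar τ = F (astar τ, τ))
    (hcontr : ∀ τ : ℝ, ‖fderiv ℝ (fun p => F (p, τ)) (astar τ)‖ < 1) :
    ContDiff ℝ k astar := by
  rw [contDiff_iff_contDiffAt]
  intro τ
  have hG : ContDiff ℝ k (fun q : ℝ × EuclideanSpace ℝ (Fin n) => q.2 - F (q.2, q.1)) := by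
    fun_prop
  have hk0 : (k : WithTop ℕ∞) ≠ 0 := by
    exact_mod_cast Nat.one_le_iff_ne_zero.mp hk
  have hdiff : DifferentiableAt ℝ (fun p => F (p, τ)) (astar τ) := by
    have hFd : Differentiable ℝ F := hF.differentiable hk0
    fun_prop
  refine hG.contDiffAt.contDiffAt_of_eventually_apply_eq hk0 ?_ hcont.continuousAt
    (Filter.Eventually.of_forall fun t => ?_)
  · rw [fderiv_fun_sub differentiableAt_fun_id hdiff, fderiv_fun_id]
    exact ContinuousLinearMap.isInvertible_id_sub_of_norm_lt_one (hcontr τ)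
  · simp only [← hfix, sub_self]
end

section
/- Let A, B : ℝⁿ → ℝ be twice continuously differentiable functions such that the Hessian ∇²A(p) is positive definite for every p, the Hessian ∇²B(p) is positive semidefinite for every p, B(p) ≥ 0 for all p, and there is no point p with A(p) = 0 and B(p) = 0 simultaneously. Then the function C(p) := A(p) + sqrt(A(p)² + B(p)²) has positive definite Hessian at every point of the set 𝒫 = { p ∈ ℝⁿ : B(p) > 0 }; in particular C is strictly convex on 𝒫. -/
section SecondDerivative

variable {E : Type*} [NormedAddCommGroup E] [NormedSpace ℝ E]

theorem ContDiff.fderiv_fderiv_add {f g : E → ℝ} (hf : ContDiff ℝ 2 f) (hg : ContDiff ℝ 2 g)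
    (p : E) :
    fderiv ℝ (fderiv ℝ fun x => f x + g x) p =
      fderiv ℝ (fderiv ℝ f) p + fderiv ℝ (fderiv ℝ g) p := by
  have hf' : Differentiable ℝ (fderiv ℝ f) :=
    (hf.fderiv_right (m := 1) (by norm_num)).differentiable (by norm_num)
  have hg' : Differentiable ℝ (fderiv ℝ g) :=
    (hg.fderiv_right (m := 1) (by norm_num)).differentiable (by norm_num)
  have h : (fderiv ℝ fun x => f x + g x) = fun x => fderiv ℝ f x + fderiv ℝ g x :=
    funext fun x => fderiv_fun_add (hf.differentiable (by norm_num) x)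
      (hg.differentiable (by norm_num) x)
  rw [h, fderiv_fun_add (hf' p) (hg' p)]

theorem ContDiff.fderiv_fderiv_sq_apply {f : E → ℝ} (hf : ContDiff ℝ 2 f) (p v : E) :
    fderiv ℝ (fderiv ℝ fun x => f x ^ 2) p v v =
      2 * (fderiv ℝ f p v ^ 2 + f p * fderiv ℝ (fderiv ℝ f) p v v) := by
  have hd : Differentiable ℝ f := hf.differentiable (by norm_num)
  have hf' : Differentiable ℝ (fderiv ℝ f) :=
    (hf.fderiv_right (m := 1) (by norm_num)).differentiable (by norm_num)
  have h : (fderiv ℝ fun x => f x ^ 2) = fun x => (2 * f x) • fderiv ℝ f x :=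
    funext fun x => by simpa using ((hd x).hasFDerivAt.pow 2).fderiv
  have h2 := (((hd p).hasFDerivAt.const_mul 2).smul (hf' p).hasFDerivAt).fderiv
  rw [h]
  refine (DFunLike.congr_fun (DFunLike.congr_fun h2 v) v).trans ?_
  simp
  ring

end SecondDerivative

/-- if `A` has positive definite Hessian everywhere, `B` has positive
semidefinite Hessian everywhere, `B ≥ 0`, and `A`, `B` never vanish simultaneously,
then `C(p) = A(p) + √(A(p)² + B(p)²)` has positive definite Hessian on
`𝒫 = {p : B(p) > 0}` (i.e., it is strictly convex there). -/
theorem stmt_12 {n : ℕ}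
    (A B : EuclideanSpace ℝ (Fin n) → ℝ)
    (hA : ContDiff ℝ 2 A) (hB : ContDiff ℝ 2 B)
    (hAposdef : ∀ p, ∀ v : EuclideanSpace ℝ (Fin n), v ≠ 0 →
      0 < fderiv ℝ (fderiv ℝ A) p v v)
    (hBpossemi : ∀ p, ∀ v : EuclideanSpace ℝ (Fin n),
      0 ≤ fderiv ℝ (fderiv ℝ B) p v v)
    (hBnonneg : ∀ p, 0 ≤ B p)
    (hnovanish : ∀ p, ¬(A p = 0 ∧ B p = 0))
    (C : EuclideanSpace ℝ (Fin n) → ℝ)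
    (hC : ∀ p, C p = A p + Real.sqrt (A p ^ 2 + B p ^ 2)) :
    ∀ p, 0 < B p → ∀ v : EuclideanSpace ℝ (Fin n), v ≠ 0 →
      0 < fderiv ℝ (fderiv ℝ C) p v v := by
  intro p hBp v hv
  have hpos : ∀ x, 0 < A x ^ 2 + B x ^ 2 := fun x => by
    rcases eq_or_ne (A x) 0 with h | h
    · have hb : B x ≠ 0 := fun hb => hnovanish x ⟨h, hb⟩
      positivity
    · positivity
  set R : EuclideanSpace ℝ (Fin n) → ℝ := fun x => Real.sqrt (A x ^ 2 + B x ^ 2)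
  have hR : ContDiff ℝ 2 R := ((hA.pow 2).add (hB.pow 2)).sqrt fun x => (hpos x).ne'
  have hRsq : ∀ x, R x ^ 2 = A x ^ 2 + B x ^ 2 := fun x => Real.sq_sqrt (hpos x).le
  have hRpos : 0 < R p := Real.sqrt_pos.2 (hpos p)
  have hfun : (fun x => R x ^ 2) = fun x => A x ^ 2 + B x ^ 2 := funext hRsq
  have hfirst : R p * fderiv ℝ R p v = A p * fderiv ℝ A p v + B p * fderiv ℝ B p v := by
    have hdA := hA.differentiable (by norm_num) p
    have hdB := hB.differentiable (by norm_num) p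
    have hdR := hR.differentiable (by norm_num) p
    have h := (hdR.hasFDerivAt.pow 2).unique
      (((hdA.hasFDerivAt.pow 2).add (hdB.hasFDerivAt.pow 2)).congr_of_eventuallyEq
        (.of_forall hRsq))
    have h' := DFunLike.congr_fun h v
    simp at h'
    linarith
  have hsecond : fderiv ℝ R p v ^ 2 + R p * fderiv ℝ (fderiv ℝ R) p v v =
      fderiv ℝ A p v ^ 2 + A p * fderiv ℝ (fderiv ℝ A) p v v +
        (fderiv ℝ B p v ^ 2 + B p * fderiv ℝ (fderiv ℝ B) p v v) := by
    have h := hR.fderiv_fderiv_sq_apply p v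
    rw [hfun, (hA.pow 2).fderiv_fderiv_add (hB.pow 2)] at h
    simp only [add_apply, hA.fderiv_fderiv_sq_apply, hB.fderiv_fderiv_sq_apply] at h
    linarith
  have hCfun : C = fun x => A x + R x := funext hC
  rw [hCfun, hA.fderiv_fderiv_add hR]
  simp only [add_apply]
  have ha := hAposdef p v hv
  have hb := hBpossemi p v
  have hRp := hRsq p
  generalize fderiv ℝ (fderiv ℝ A) p v v = a₂ at *
  generalize fderiv ℝ (fderiv ℝ B) p v v = b₂ at *
  generalize fderiv ℝ (fderiv ℝ R) p v v = r₂ at *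
  generalize fderiv ℝ A p v = a₁ at *
  generalize fderiv ℝ B p v = b₁ at *
  generalize fderiv ℝ R p v = r₁ at *
  have hcauchy : r₁ ^ 2 ≤ a₁ ^ 2 + b₁ ^ 2 := by
    refine le_of_mul_le_mul_left ?_ (pow_pos hRpos 2)
    rw [← mul_pow, hfirst, hRp]
    nlinarith [sq_nonneg (A p * b₁ - B p * a₁)]
  have hRA : 0 < R p + A p := by
    have := abs_lt_of_sq_lt_sq (show A p ^ 2 < R p ^ 2 by nlinarith) hRpos.le
    linarith [neg_abs_le (A p), this]
  refine pos_of_mul_pos_right (b := a₂ + r₂) (a := R p) ?_ hRpos.le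
  nlinarith [mul_pos hRA ha, mul_nonneg hBp.le hb]
end

section
/- Let h > 0 and let k ≥ 2 be an integer. Define Φ : ℝ → ℝ by Φ(s) = ∫₀^s ∫₀^ξ (1 − (r+1)^{−1/h})^{k−1} dr dξ for s ≥ 0 and Φ(s) = 0 for s < 0. Then: Φ(s) ≥ 0 for all s; Φ(s) = 0 if and only if s ≤ 0; Φ is k times differentiable on ℝ; Φ''(s) = (1 − (s+1)^{−1/h})^{k−1} for s ≥ 0 and Φ''(s) = 0 for s ≤ 0; and 0 < Φ''(s) < 1 for every s > 0. -/
open Set Filter Topology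
open scoped ContDiff

/-- Extending by zero to the left of the origin preserves differentiability when the function and
its derivative vanish at the origin. -/
lemma hasDerivAt_ite_nonneg {f f' : ℝ → ℝ} (hf : ∀ s, 0 ≤ s → HasDerivAt f (f' s) s)
    (f_zero : f 0 = 0) (f'_zero : f' 0 = 0) (s : ℝ) :
    HasDerivAt (fun x => if 0 ≤ x then f x else 0) (if 0 ≤ s then f' s else 0) s := by
  rcases lt_trichotomy s 0 with hs | rfl | hs
  · rw [if_neg hs.not_ge]
    refine (hasDerivAt_const s (0 : ℝ)).congr_of_eventuallyEq ?_
    filter_upwards [Iio_mem_nhds hs] with x hx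
    exact if_neg (not_le.mpr hx)
  · rw [if_pos le_rfl, f'_zero, ← hasDerivWithinAt_univ, ← Iic_union_Ici (a := (0 : ℝ))]
    refine HasDerivWithinAt.union ?_ ?_
    · refine (hasDerivWithinAt_const (0 : ℝ) (Iic 0) (0 : ℝ)).congr (fun x hx => ?_) ?_
      · rcases (mem_Iic.mp hx).eq_or_lt with rfl | hx
        · rw [if_pos le_rfl, f_zero]
        · exact if_neg hx.not_ge
      · rw [if_pos le_rfl, f_zero]
    · have h0 := (hf 0 le_rfl).hasDerivWithinAt (s := Ici 0)
      rw [f'_zero] at h0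
      exact h0.congr (fun x hx => if_pos hx) (if_pos le_rfl)
  · rw [if_pos hs.le]
    refine (hf s hs.le).congr_of_eventuallyEq ?_
    filter_upwards [Ioi_mem_nhds hs] with x hx
    exact if_pos (le_of_lt hx)

/-- If `p` and `f` are smooth on `[0, ∞)` and `p 0 = 0`, then the extension by zero of
`p ^ (n + 1) * f` is of class `C^n`. -/
lemma contDiff_ite_nonneg_pow_mul {p : ℝ → ℝ} (hp : ∀ s, 0 ≤ s → ContDiffAt ℝ ∞ p s)
    (p_zero : p 0 = 0) (n : ℕ) {f : ℝ → ℝ} (hf : ∀ s, 0 ≤ s → ContDiffAt ℝ ∞ f s) :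
    ContDiff ℝ n (fun s => if 0 ≤ s then p s ^ (n + 1) * f s else 0) := by
  induction n generalizing f with
  | zero =>
    refine contDiff_zero.mpr (continuous_if ?_ ?_ continuousOn_const)
    · intro a ha
      have : a = 0 := by
        change a ∈ frontier (Ici 0) at ha
        simpa using ha
      simp [this, p_zero]
    · intro a ha
      replace ha : 0 ≤ a := by
        change a ∈ closure (Ici 0) at ha
        simpa using ha
      exact (((hp a ha).continuousAt.pow _).mul (hf a ha).continuousAt).continuousWithinAt
  | succ n ih =>
    have key := hasDerivAt_ite_nonneg (f := fun s => p s ^ (n + 1 + 1) * f s)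
      (f' := fun s => p s ^ (n + 1) * ((n + 2) * deriv p s * f s + p s * deriv f s))
      (fun s hs => by
        have h1 := ((hp s hs).differentiableAt (by simp)).hasDerivAt
        have h2 := ((hf s hs).differentiableAt (by simp)).hasDerivAt
        refine ((h1.pow (n + 1 + 1)).mul h2).congr_deriv ?_
        rw [Nat.add_sub_cancel, Pi.pow_apply]
        push_cast
        ring) (by simp [p_zero]) (by simp [p_zero])
    push_cast
    refine contDiff_succ_iff_deriv.mpr ⟨fun s => (key s).differentiableAt, by simp, ?_⟩
    rw [funext fun s => (key s).deriv]
    refine ih fun s hs => ?_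
    have h1 : ContDiffAt ℝ ∞ (deriv p) s := (hp s hs).derivWithin (by simp)
    have h2 : ContDiffAt ℝ ∞ (deriv f) s := (hf s hs).derivWithin (by simp)
    exact ((contDiffAt_const.mul h1).mul (hf s hs)).add ((hp s hs).mul h2)

/-- The fundamental theorem of calculus for a function continuous on an open half-line. -/
lemma hasDerivAt_integral_of_continuousOn_Ioi {g : ℝ → ℝ} {a b s : ℝ}
    (hg : ContinuousOn g (Ioi a)) (hb : a < b) (hs : a < s) :
    HasDerivAt (fun x => ∫ r in b..x, g r) (g s) s := by
  refine intervalIntegral.integral_hasDerivAt_right ?_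
    (hg.stronglyMeasurableAtFilter isOpen_Ioi s hs) (hg.continuousAt (Ioi_mem_nhds hs))
  exact (hg.mono fun x hx => (lt_min hb hs).trans_le hx.1).intervalIntegrable

/-- the basic k-P2S function
`Φ(s) = ∫₀^s ∫₀^ξ (1 − (r+1)^(−1/h))^(k−1) dr dξ` for `s ≥ 0` and `Φ(s) = 0` for
`s < 0` is nonnegative, vanishes exactly on `s ≤ 0`, is `k` times differentiable,
has `Φ''(s) = (1 − (s+1)^(−1/h))^(k−1)` for `s ≥ 0` and `Φ''(s) = 0` for `s ≤ 0`,
and `0 < Φ''(s) < 1` for `s > 0`. -/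
theorem stmt_18 (h : ℝ) (hh : 0 < h) (k : ℕ) (hk : 2 ≤ k)
    (Φ : ℝ → ℝ)
    (hΦ : ∀ s : ℝ, Φ s =
      if 0 ≤ s then
        ∫ ξ in (0:ℝ)..s, ∫ r in (0:ℝ)..ξ, (1 - (r + 1) ^ (-1 / h)) ^ (k - 1)
      else 0) :
    (∀ s, 0 ≤ Φ s) ∧
    (∀ s, Φ s = 0 ↔ s ≤ 0) ∧
    (∀ m < k, Differentiable ℝ (iteratedDeriv m Φ)) ∧
    (∀ s : ℝ, 0 ≤ s → deriv (deriv Φ) s = (1 - (s + 1) ^ (-1 / h)) ^ (k - 1)) ∧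
    (∀ s : ℝ, s ≤ 0 → deriv (deriv Φ) s = 0) ∧
    (∀ s : ℝ, 0 < s → 0 < deriv (deriv Φ) s ∧ deriv (deriv Φ) s < 1) := by
  obtain ⟨n, rfl⟩ := Nat.exists_eq_add_of_le' hk
  rw [show n + 2 - 1 = n + 1 from rfl] at *
  set p : ℝ → ℝ := fun s => 1 - (s + 1) ^ (-1 / h) with p_def
  have exponent_neg : -1 / h < 0 := div_neg_of_neg_of_pos (by norm_num) hh
  have p_zero : p 0 = 0 := by simp [p_def]
  have p_smooth : ∀ s, -1 < s → ContDiffAt ℝ ∞ p s := fun s hs =>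
    contDiffAt_const.sub
      ((contDiffAt_id.add contDiffAt_const).rpow_const_of_ne (by simp; linarith))
  have p_pos : ∀ s, 0 < s → 0 < p s := fun s hs =>
    sub_pos.mpr (Real.rpow_lt_one_of_one_lt_of_neg (by linarith) exponent_neg)
  have p_lt_one : ∀ s, 0 < s → p s < 1 := fun s hs =>
    sub_lt_self _ (Real.rpow_pos_of_pos (by linarith) _)
  have g_cont : ContinuousOn (fun s => p s ^ (n + 1)) (Ioi (-1)) := fun s hs =>
    ((p_smooth s hs).continuousAt.pow _).continuousWithinAt
  have inner_deriv : ∀ s, -1 < s →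
      HasDerivAt (fun x => ∫ r in (0 : ℝ)..x, p r ^ (n + 1)) (p s ^ (n + 1)) s := fun s hs =>
    hasDerivAt_integral_of_continuousOn_Ioi g_cont (by norm_num) hs
  have inner_cont : ContinuousOn (fun x => ∫ r in (0 : ℝ)..x, p r ^ (n + 1)) (Ioi (-1)) :=
    fun s hs => (inner_deriv s hs).continuousAt.continuousWithinAt
  have outer_deriv : ∀ s, -1 < s →
      HasDerivAt (fun x => ∫ ξ in (0 : ℝ)..x, ∫ r in (0 : ℝ)..ξ, p r ^ (n + 1))
        (∫ r in (0 : ℝ)..s, p r ^ (n + 1)) s := fun s hs =>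
    hasDerivAt_integral_of_continuousOn_Ioi inner_cont (by norm_num) hs
  have Φ_deriv := hasDerivAt_ite_nonneg (fun s hs => outer_deriv s (by linarith))
    (by simp) (by simp)
  have Φ_deriv_deriv := hasDerivAt_ite_nonneg (fun s hs => inner_deriv s (by linarith))
    (by simp) (by simp [p_zero])
  rw [← show Φ = _ from funext hΦ] at Φ_deriv
  have deriv_eq := funext fun s => (Φ_deriv s).deriv
  have deriv_deriv_eq : deriv (deriv Φ) = fun s => if 0 ≤ s then p s ^ (n + 1) else 0 := by
    rw [deriv_eq]
    exact funext fun s => (Φ_deriv_deriv s).deriv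
  have Φ_contDiff : ContDiff ℝ ((n + 2 : ℕ) : ℕ∞ω) Φ := by
    have base := contDiff_ite_nonneg_pow_mul (fun s hs => p_smooth s (by linarith)) p_zero n
      (f := fun _ => 1) (fun _ _ => contDiffAt_const)
    simp only [mul_one] at base
    rw [show ((n + 2 : ℕ) : ℕ∞ω) = n + 1 + 1 by push_cast; rw [add_assoc, one_add_one_eq_two]]
    refine contDiff_succ_iff_deriv.mpr ⟨fun s => (Φ_deriv s).differentiableAt, by simp, ?_⟩
    refine contDiff_succ_iff_deriv.mpr ⟨?_, by simp, deriv_deriv_eq ▸ base⟩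
    rw [deriv_eq]
    exact fun s => (Φ_deriv_deriv s).differentiableAt
  have inner_pos : ∀ s, 0 < s → 0 < ∫ r in (0 : ℝ)..s, p r ^ (n + 1) := fun s hs =>
    intervalIntegral.intervalIntegral_pos_of_pos_on
      (g_cont.mono fun x hx => by
        rw [uIcc_of_le hs.le] at hx; exact lt_of_lt_of_le (by norm_num) hx.1).intervalIntegrable
      (fun x hx => pow_pos (p_pos x hx.1) _) hs
  have Φ_pos : ∀ s, 0 < s → 0 < Φ s := fun s hs => by
    rw [hΦ, if_pos hs.le]
    exact intervalIntegral.intervalIntegral_pos_of_pos_on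
      (inner_cont.mono fun x hx => by
        rw [uIcc_of_le hs.le] at hx; exact lt_of_lt_of_le (by norm_num) hx.1).intervalIntegrable
      (fun x hx => inner_pos x hx.1) hs
  have Φ_zero : ∀ s, s ≤ 0 → Φ s = 0 := fun s hs => by
    rcases hs.eq_or_lt with rfl | hs
    · simp [hΦ]
    · rw [hΦ, if_neg hs.not_ge]
  refine ⟨fun s => ?_, fun s => ⟨fun hs => ?_, Φ_zero s⟩, fun m hm => ?_, fun s hs => ?_,
    fun s hs => ?_, fun s hs => ?_⟩
  · rcases le_or_gt s 0 with hs | hs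
    · exact (Φ_zero s hs).ge
    · exact (Φ_pos s hs).le
  · by_contra! hs'
    exact (Φ_pos s hs').ne' hs
  · exact Φ_contDiff.differentiable_iteratedDeriv m (by exact_mod_cast hm)
  · simp only [deriv_deriv_eq, if_pos hs, p_def]
  · rw [deriv_deriv_eq]
    rcases hs.eq_or_lt with rfl | hs
    · simp [p_zero]
    · exact if_neg hs.not_ge
  · simp only [deriv_deriv_eq, if_pos hs.le]
    exact ⟨pow_pos (p_pos s hs) _, pow_lt_one₀ (p_pos s hs).le (p_lt_one s hs) (by simp)⟩
end
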